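/- For every n ≥ 3, the wheel W_n is in host(K_3): any two K_3-models of W_n are connected by a sequence of K_3-models in which consecutive models differ on exactly one vertex. -/

import Mathlib

open SimpleGraph

section Defs

variable {V : Type*} {W : Type*}

/-- `f` is an `H`-model of `G`: every branch set (preimage of a label) is nonempty and
connected, and for every edge of `H` there is a connecting edge of `G`. -/
def IsModel (G : SimpleGraph V) (H : SimpleGraph W) (f : V → W) : Prop :=
  (∀ i : W, (f ⁻¹' {i}).Nonempty ∧ (G.induce (f ⁻¹' {i})).Connected) ∧
  ∀ ⦃i j : W⦄, H.Adj i j → ∃ u v : V, G.Adj u v ∧ f u = i ∧ f v = j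

/-- One reconfiguration step: both endpoints are `H`-models and they differ on exactly
one vertex of `G`. -/
def ModelStep (G : SimpleGraph V) (H : SimpleGraph W) (f g : V → W) : Prop :=
  IsModel G H f ∧ IsModel G H g ∧ ∃ v : V, f v ≠ g v ∧ ∀ u : V, u ≠ v → f u = g u

/-- `G` is in `host(H)`: it admits an `H`-model and the reconfiguration graph of
`H`-models of `G` is connected. -/
def InHost (G : SimpleGraph V) (H : SimpleGraph W) : Prop :=
  (∃ f : V → W, IsModel G H f) ∧
  ∀ f g : V → W, IsModel G H f → IsModel G H g →
    Relation.ReflTransGen (ModelStep G H) f g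

/-- `S` is a cut set of `G`: deleting `S` leaves at least two components. -/
def IsCutSet (G : SimpleGraph V) (S : Set V) : Prop :=
  ∃ u w : ↥(Sᶜ), ¬ (G.induce Sᶜ).Reachable u w

/-- `G` is `k`-connected: it has no cut set of fewer than `k` vertices. -/
def KConnected (G : SimpleGraph V) (k : ℕ) : Prop :=
  ∀ S : Set V, S.Finite → S.ncard < k → ¬ IsCutSet G S

/-- `v` is a cut vertex of the subgraph of `G` induced on `A`. -/
def IsCutVertexOf (G : SimpleGraph V) (A : Set V) (v : V) : Prop :=
  v ∈ A ∧ ∃ u w : ↥(A \ {v}), ¬ (G.induce (A \ {v})).Reachable u w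

def NoCutVertexIn (G : SimpleGraph V) (B : Set V) : Prop :=
  ∀ v : V, ¬ IsCutVertexOf G B v

/-- `B` is a block of the subgraph of `G` induced on `A`: a maximal connected subgraph
of it without a cut vertex. -/
def IsBlockOf (G : SimpleGraph V) (A B : Set V) : Prop :=
  B ⊆ A ∧ B.Nonempty ∧ (G.induce B).Connected ∧ NoCutVertexIn G B ∧
  ∀ B' : Set V, B ⊆ B' → B' ⊆ A → (G.induce B').Connected → NoCutVertexIn G B' → B' = B

/-- `B` is a leaf block of the subgraph of `G` induced on `A`: a block containing at
most one joining vertex (cut vertex of the induced subgraph on `A`). -/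
def IsLeafBlockOf (G : SimpleGraph V) (A B : Set V) : Prop :=
  IsBlockOf G A B ∧
  ∀ v w : V, v ∈ B → w ∈ B → IsCutVertexOf G A v → IsCutVertexOf G A w → v = w

/-- `v` is essential for label `b`: `f v` and `b` are adjacent labels of `H` and every
connecting edge between the branch sets of `f v` and of `b` has `v` as an endpoint. -/
def EssentialFor (G : SimpleGraph V) (H : SimpleGraph W) (f : V → W) (v : V) (b : W) : Prop :=
  H.Adj (f v) b ∧ ∀ u w : V, G.Adj u w → f u = f v → f w = b → u = v

/-- `v` is crucial: essential for two distinct labels. -/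
def IsCrucial (G : SimpleGraph V) (H : SimpleGraph W) (f : V → W) (v : V) : Prop :=
  ∃ b c : W, b ≠ c ∧ EssentialFor G H f v b ∧ EssentialFor G H f v c

/-- `v` is `b`-crucial: `v` has a neighbour labeled `b` and is essential for some label
`c ∉ {f v, b}`. -/
def IsBCrucial (G : SimpleGraph V) (H : SimpleGraph W) (f : V → W) (v : V) (b : W) : Prop :=
  (∃ u : V, G.Adj v u ∧ f u = b) ∧
  ∃ c : W, c ≠ f v ∧ c ≠ b ∧ EssentialFor G H f v c

/-- `uv` is the unique (essential) connecting edge between branch sets `a` and `b`. -/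
def IsEssEdge (G : SimpleGraph V) (f : V → W) (a b : W) (u v : V) : Prop :=
  G.Adj u v ∧ f u = a ∧ f v = b ∧
  ∀ u' v' : V, G.Adj u' v' → f u' = a → f v' = b → u' = u ∧ v' = v

/-- The branch sets of labels `a` and `b` are weakly connected. -/
def WeaklyConnected (G : SimpleGraph V) (H : SimpleGraph W) (f : V → W) (a b : W) : Prop :=
  (∃ v : V, f v = a ∧ EssentialFor G H f v b) ∨
  (∃ v : V, f v = b ∧ EssentialFor G H f v a)

/-- `p` is a valid designation of a lynchpin for the weak connection between the branch
sets of `a` and `b`: an endpoint of the essential edge if one exists, and otherwise the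
essential vertex giving rise to the weak connection. -/
def IsLynchpin (G : SimpleGraph V) (H : SimpleGraph W) (f : V → W) (a b : W) (p : V) : Prop :=
  (∃ u v : V, IsEssEdge G f a b u v ∧ (p = u ∨ p = v)) ∨
  ((∀ u v : V, ¬ IsEssEdge G f a b u v) ∧
    ((f p = a ∧ EssentialFor G H f p b) ∨ (f p = b ∧ EssentialFor G H f p a)))

/-- `C` is a connected component of the subgraph of `G` induced on `A`. -/
def IsCompOf (G : SimpleGraph V) (A C : Set V) : Prop :=
  C ⊆ A ∧ C.Nonempty ∧ (G.induce C).Connected ∧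
  ∀ C' : Set V, C ⊆ C' → C' ⊆ A → (G.induce C').Connected → C' = C

/-- One reconfiguration step that changes (the label of) a vertex of `A` only. -/
def ModelStepWithin (G : SimpleGraph V) (H : SimpleGraph W) (A : Set V) (f g : V → W) : Prop :=
  IsModel G H f ∧ IsModel G H g ∧ ∃ v ∈ A, f v ≠ g v ∧ ∀ u : V, u ≠ v → f u = g u

/-- `g` is reachable from `f` by reconfiguration steps changing only vertices of `A`. -/
def ReachWithin (G : SimpleGraph V) (H : SimpleGraph W) (A : Set V) (f g : V → W) : Prop :=
  Relation.ReflTransGen (ModelStepWithin G H A) f g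

/-- `f` is a leaf-crucial model: some crucial vertex is an interior vertex in a leaf
block of its branch set. -/
def LeafCrucialModel (G : SimpleGraph V) (H : SimpleGraph W) (f : V → W) : Prop :=
  ∃ (v : V) (L : Set V), IsLeafBlockOf G (f ⁻¹' {f v}) L ∧ v ∈ L ∧
    ¬ IsCutVertexOf G (f ⁻¹' {f v}) v ∧ IsCrucial G H f v

/-- `f` is a leaf-`b`-crucial model: some `b`-crucial vertex is an interior vertex in a
leaf block of its branch set. -/
def LeafBCrucialModel (G : SimpleGraph V) (H : SimpleGraph W) (f : V → W) (b : W) : Prop :=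
  ∃ (v : V) (L : Set V), IsLeafBlockOf G (f ⁻¹' {f v}) L ∧ v ∈ L ∧
    ¬ IsCutVertexOf G (f ⁻¹' {f v}) v ∧ IsBCrucial G H f v b

/-- `f` hits a leaf-crucial model on relabeling `A`. -/
def HitsLeafCrucial (G : SimpleGraph V) (H : SimpleGraph W) (A : Set V) (f : V → W) : Prop :=
  ∀ g : V → W, ReachWithin G H A f g →
    ∃ h : V → W, ReachWithin G H A g h ∧ LeafCrucialModel G H h

/-- `f` hits a leaf-`b`-crucial model on relabeling `A`. -/
def HitsLeafBCrucial (G : SimpleGraph V) (H : SimpleGraph W) (A : Set V) (f : V → W)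
    (b : W) : Prop :=
  ∀ g : V → W, ReachWithin G H A f g →
    ∃ h : V → W, ReachWithin G H A g h ∧ LeafBCrucialModel G H h b

end Defs

/-- The `n`-wheel `W_n`: rim vertices `some i` for `i : Fin n` inducing a cycle, and a
hub vertex `none` adjacent to every rim vertex. -/
def wheelGraph (n : ℕ) : SimpleGraph (Option (Fin n)) :=
  SimpleGraph.fromRel (fun p q =>
    match p, q with
    | none, some _ => True
    | some i, some j => (j : ℕ) = ((i : ℕ) + 1) % n
    | _, _ => False)

section Cone

variable {V : Type*} {G : SimpleGraph V}

lemma ModelStep.symm {W : Type*} {H : SimpleGraph W} {f g : V → W} (h : ModelStep G H f g) :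
    ModelStep G H g f := by
  obtain ⟨hf, hg, v, hv, huv⟩ := h
  exact ⟨hg, hf, v, hv.symm, fun u hu => (huv u hu).symm⟩

lemma reflTransGen_modelStep_symm {W : Type*} {H : SimpleGraph W} {f g : V → W}
    (h : Relation.ReflTransGen (ModelStep G H) f g) :
    Relation.ReflTransGen (ModelStep G H) g f := by
  induction h with
  | refl => exact .refl
  | tail _ hs ih => exact .head hs.symm ih

lemma reflTransGen_modelStep_of_eqOn_compl {W : Type*} {H : SimpleGraph W} {f g : V → W}
    (hf : IsModel G H f) (hg : IsModel G H g) (v : V) (h : ∀ u, u ≠ v → f u = g u) :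
    Relation.ReflTransGen (ModelStep G H) f g := by
  by_cases hv : f v = g v
  · have : f = g := by
      funext u
      by_cases hu : u = v
      · rw [hu, hv]
      · exact h u hu
    rw [this]
  · exact .single ⟨hf, hg, v, hv, h⟩

lemma connected_induce_insert {s : Set V} {v x : V} (hs : (G.induce s).Connected)
    (hv : v ∈ s) (hvx : G.Adj v x) : (G.induce (insert x s)).Connected := by
  have : insert x s = s ∪ {v, x} := by
    ext y
    simp only [Set.mem_insert_iff, Set.mem_union, Set.mem_singleton_iff]
    constructor
    · rintro (rfl | h) <;> simp [*]
    · rintro (h | rfl | h) <;> simp [*]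
  rw [this]
  exact induce_union_connected hs.preconnected (induce_pair_connected_of_adj hvx).preconnected
    ⟨v, hv, by simp⟩

lemma connected_induce_singleton (v : V) : (G.induce {v}).Connected := by
  rw [induce_singleton_eq_top]
  exact connected_top

lemma exists_adj_of_connected_induce {s t : Set V} (ht : (G.induce t).Connected)
    (hst : s ⊂ t) (hs : s.Nonempty) : ∃ x ∈ s, ∃ y ∈ t, y ∉ s ∧ G.Adj x y := by
  obtain ⟨y, hyt, hys⟩ := Set.exists_of_ssubset hst
  obtain ⟨x, hx⟩ := hs
  obtain ⟨p⟩ := ht.preconnected ⟨x, hst.subset hx⟩ ⟨y, hyt⟩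
  obtain ⟨d, -, h1, h2⟩ := p.exists_boundary_dart (Subtype.val ⁻¹' s) hx hys
  exact ⟨d.fst, h1, d.snd, d.snd.2, h2, d.adj⟩

open Classical in
/-- The labelling with label `b` on `B`, label `c` on `C` and label `a` elsewhere. -/
noncomputable def splitLabel (a b c : Fin 3) (B C : Set V) : V → Fin 3 :=
  fun x => if x ∈ B then b else if x ∈ C then c else a

/-- `B` and `C` are disjoint, connected, joined by an edge, and avoid the vertex `h`. -/
structure IsSplit (G : SimpleGraph V) (h : V) (B C : Set V) : Prop where
  left : h ∉ B
  right : h ∉ C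
  disj : Disjoint B C
  connLeft : (G.induce B).Connected
  connRight : (G.induce C).Connected
  adj : ∃ u ∈ B, ∃ v ∈ C, G.Adj u v

lemma IsSplit.symm {h : V} {B C : Set V} (H : IsSplit G h B C) : IsSplit G h C B := by
  obtain ⟨h1, h2, h3, h4, h5, u, hu, v, hv, huv⟩ := H
  exact ⟨h2, h1, h3.symm, h5, h4, v, hv, u, hu, huv.symm⟩

lemma splitLabel_apply_congr {a b c : Fin 3} {B C B' C' : Set V} {x : V} (hB : x ∈ B ↔ x ∈ B')
    (hC : x ∈ C ↔ x ∈ C') : splitLabel a b c B C x = splitLabel a b c B' C' x := by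
  unfold splitLabel
  split_ifs <;> tauto

lemma splitLabel_swap {a b c : Fin 3} {B C : Set V} (h : Disjoint B C) :
    splitLabel a b c B C = splitLabel a c b C B := by
  funext x
  have : x ∈ B → x ∉ C := fun hx => Set.disjoint_left.1 h hx
  unfold splitLabel
  split_ifs <;> tauto

lemma IsSplit.isModel {h : V} (hh : ∀ x, x ≠ h → G.Adj h x) {B C : Set V}
    (H : IsSplit G h B C) {a b c : Fin 3} (hab : a ≠ b) (hac : a ≠ c) (hbc : b ≠ c) :
    IsModel G ⊤ (splitLabel a b c B C) := by
  obtain ⟨hB, hC, hd, cB, cC, u, hu, v, hv, huv⟩ := H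
  have hd' : ∀ x, x ∈ B → x ∉ C := fun x hx => Set.disjoint_left.1 hd hx
  have hvB : v ∉ B := fun h => hd' v h hv
  have fh : splitLabel a b c B C h = a := by simp [splitLabel, hB, hC]
  have fu : splitLabel a b c B C u = b := by simp [splitLabel, hu]
  have fv : splitLabel a b c B C v = c := by simp [splitLabel, hv, hvB]
  have hub : h ≠ u := by rintro rfl; exact hB hu
  have hvc : h ≠ v := by rintro rfl; exact hC hv
  have eB : splitLabel a b c B C ⁻¹' {b} = B := by
    ext x
    simp only [splitLabel, Set.mem_preimage, Set.mem_singleton_iff]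
    split_ifs <;> simp_all
    exact fun e => hbc e.symm
  have eC : splitLabel a b c B C ⁻¹' {c} = C := by
    ext x
    have := hd' x
    simp only [splitLabel, Set.mem_preimage, Set.mem_singleton_iff]
    split_ifs <;> simp_all
  have cA : (G.induce (splitLabel a b c B C ⁻¹' {a})).Connected := by
    rw [connected_iff_exists_forall_reachable]
    refine ⟨⟨h, fh⟩, fun w => ?_⟩
    by_cases hw : w.1 = h
    · rw [← show w = ⟨h, fh⟩ from Subtype.ext hw]
    · exact Adj.reachable (G := G.induce _) (hh _ hw)
  have tri : ∀ i : Fin 3, i = a ∨ i = b ∨ i = c := by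
    intro i
    omega
  refine ⟨fun i => ?_, fun i j hij => ?_⟩
  · rcases tri i with rfl | rfl | rfl
    · exact ⟨⟨h, fh⟩, cA⟩
    · exact ⟨⟨u, fu⟩, by rwa [eB]⟩
    · exact ⟨⟨v, fv⟩, by rwa [eC]⟩
  · have hij' : i ≠ j := hij
    rcases tri i with rfl | rfl | rfl <;> rcases tri j with rfl | rfl | rfl
    · exact absurd rfl hij'
    · exact ⟨h, u, hh u hub.symm, fh, fu⟩
    · exact ⟨h, v, hh v hvc.symm, fh, fv⟩
    · exact ⟨u, h, (hh u hub.symm).symm, fu, fh⟩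
    · exact absurd rfl hij'
    · exact ⟨u, v, huv, fu, fv⟩
    · exact ⟨v, h, (hh v hvc.symm).symm, fv, fh⟩
    · exact ⟨v, u, huv.symm, fv, fu⟩
    · exact absurd rfl hij'

/-- The left part of a split can be shrunk to any of its vertices that has a neighbour in the
right part. -/
lemma IsSplit.reflTransGen_singleton_left [Finite V] {h : V} (hh : ∀ x, x ≠ h → G.Adj h x)
    {B C : Set V} (H : IsSplit G h B C) {a b c : Fin 3} (hab : a ≠ b) (hac : a ≠ c) (hbc : b ≠ c)
    {u v : V} (hu : u ∈ B) (hv : v ∈ C) (huv : G.Adj u v) :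
    Relation.ReflTransGen (ModelStep G ⊤) (splitLabel a b c B C) (splitLabel a b c {u} C) := by
  have split : ∀ S ⊆ B, u ∈ S → (G.induce S).Connected → IsSplit G h S C := fun S hS huS cS =>
    ⟨fun h => H.left (hS h), H.right, H.disj.mono_left hS, cS, H.connRight, u, huS, v, hv, huv⟩
  have key : ∀ k : ℕ, ∀ S ⊆ B, u ∈ S → (G.induce S).Connected → (B \ S).ncard = k →
      Relation.ReflTransGen (ModelStep G ⊤) (splitLabel a b c B C) (splitLabel a b c S C) := by
    intro k
    induction k with
    | zero =>
      intro S hS _ _ hk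
      rw [Set.ncard_eq_zero, Set.sdiff_eq_empty] at hk
      rw [hS.antisymm hk]
    | succ k ih =>
      intro S hS huS cS hk
      have hne : S ≠ B := by
        rintro rfl
        simp at hk
      obtain ⟨x, hx, y, hyB, hyS, hxy⟩ :=
        exists_adj_of_connected_induce H.connLeft (hS.ssubset_of_ne hne) ⟨u, huS⟩
      have hS' : insert y S ⊆ B := Set.insert_subset hyB hS
      have cS' := connected_induce_insert cS hx hxy
      refine (ih _ hS' (by simp [huS]) cS' ?_).trans ?_
      · have : B \ S = insert y (B \ insert y S) := by
          ext z
          by_cases hz : z = y <;> simp [hz, hyB, hyS]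
        rw [this, Set.ncard_insert_of_notMem (by simp)] at hk
        omega
      · refine reflTransGen_modelStep_of_eqOn_compl
          ((split _ hS' (by simp [huS]) cS').isModel hh hab hac hbc)
          ((split _ hS huS cS).isModel hh hab hac hbc) y fun z hz => ?_
        exact splitLabel_apply_congr (by simp [hz]) .rfl
  exact key _ {u} (by simpa using hu) rfl (connected_induce_singleton u) rfl

lemma IsSplit.reflTransGen_singleton_right [Finite V] {h : V} (hh : ∀ x, x ≠ h → G.Adj h x)
    {B C : Set V} (H : IsSplit G h B C) {a b c : Fin 3} (hab : a ≠ b) (hac : a ≠ c) (hbc : b ≠ c)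
    {u v : V} (hu : u ∈ B) (hv : v ∈ C) (huv : G.Adj u v) :
    Relation.ReflTransGen (ModelStep G ⊤) (splitLabel a b c B C) (splitLabel a b c B {v}) := by
  rw [splitLabel_swap H.disj,
    splitLabel_swap (H.disj.mono_right (Set.singleton_subset_iff.2 hv))]
  exact H.symm.reflTransGen_singleton_left hh hac hab hbc.symm hv hu huv.symm

/-- The labelling with label `b` on `u`, label `c` on `v` and label `a` elsewhere. -/
noncomputable abbrev pairLabel (a b c : Fin 3) (u v : V) : V → Fin 3 :=
  splitLabel a b c {u} {v}

lemma pairLabel_swap {a b c : Fin 3} {u v : V} (h : u ≠ v) :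
    pairLabel a b c u v = pairLabel a c b v u :=
  splitLabel_swap (by simpa using h)

lemma isSplit_singletons {h u v : V} (hu : u ≠ h) (hv : v ≠ h) (huv : G.Adj u v) :
    IsSplit G h {u} {v} :=
  ⟨by simpa using hu.symm, by simpa using hv.symm, by simpa using huv.ne,
    connected_induce_singleton u, connected_induce_singleton v, u, rfl, v, rfl, huv⟩

lemma exists_reflTransGen_pairLabel [Finite V] {h : V} (hh : ∀ x, x ≠ h → G.Adj h x)
    {f : V → Fin 3} (hf : IsModel G ⊤ f) :
    ∃ a b c : Fin 3, ∃ u v : V, a ≠ b ∧ a ≠ c ∧ b ≠ c ∧ u ≠ h ∧ v ≠ h ∧ G.Adj u v ∧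
      Relation.ReflTransGen (ModelStep G ⊤) f (pairLabel a b c u v) := by
  obtain ⟨b, c, hab, hac, hbc, tri⟩ : ∃ b c : Fin 3, f h ≠ b ∧ f h ≠ c ∧ b ≠ c ∧
      ∀ i, i = f h ∨ i = b ∨ i = c := by
    generalize f h = a
    revert a
    decide
  obtain ⟨u, v, huv, hu, hv⟩ := hf.2 (show (⊤ : SimpleGraph (Fin 3)).Adj b c from hbc)
  have hS : IsSplit G h (f ⁻¹' {b}) (f ⁻¹' {c}) := by
    refine ⟨hab, hac, ?_, (hf.1 b).2, (hf.1 c).2, u, hu, v, hv, huv⟩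
    rw [Set.disjoint_left]
    intro x hx hx'
    exact hbc (hx.symm.trans hx')
  have hfe : f = splitLabel (f h) b c (f ⁻¹' {b}) (f ⁻¹' {c}) := by
    funext x
    have := tri (f x)
    simp only [splitLabel, Set.mem_preimage, Set.mem_singleton_iff]
    split_ifs <;> tauto
  refine ⟨f h, b, c, u, v, hab, hac, hbc, ?_, ?_, huv, ?_⟩
  · rintro rfl; exact hab hu
  · rintro rfl; exact hac hv
  · have h1 := hS.reflTransGen_singleton_left hh hab hac hbc hu hv huv
    have h2 : IsSplit G h {u} (f ⁻¹' {c}) :=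
      ⟨fun e => hab (e ▸ hu), hac, hS.disj.mono_left (Set.singleton_subset_iff.2 hu),
        connected_induce_singleton u, hS.connRight, u, rfl, v, hv, huv⟩
    rw [← hfe] at h1
    exact h1.trans (h2.reflTransGen_singleton_right hh hab hac hbc rfl hv huv)

lemma reflTransGen_pairLabel_flip [Finite V] {h : V} (hh : ∀ x, x ≠ h → G.Adj h x)
    {a b c : Fin 3} (hab : a ≠ b) (hac : a ≠ c) (hbc : b ≠ c)
    {u v w : V} (hu : u ≠ h) (hv : v ≠ h) (hw : w ≠ h)
    (huv : G.Adj u v) (huw : G.Adj u w) (hconn : (G.induce {x | x ≠ h ∧ x ≠ u}).Connected) :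
    Relation.ReflTransGen (ModelStep G ⊤) (pairLabel a b c u v) (pairLabel a b c u w) := by
  have hS : IsSplit G h {u} {x | x ≠ h ∧ x ≠ u} :=
    ⟨by simpa using hu.symm, by simp, by simp, connected_induce_singleton u, hconn,
      u, rfl, v, ⟨hv, huv.ne.symm⟩, huv⟩
  exact (reflTransGen_modelStep_symm (hS.reflTransGen_singleton_right hh hab hac hbc rfl
    ⟨hv, huv.ne.symm⟩ huv)).trans
    (hS.reflTransGen_singleton_right hh hab hac hbc rfl ⟨hw, huw.ne.symm⟩ huw)

lemma reflTransGen_pairLabel_slide [Finite V] {h : V} (hh : ∀ x, x ≠ h → G.Adj h x)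
    {a b c : Fin 3} (hab : a ≠ b) (hac : a ≠ c) (hbc : b ≠ c)
    {u v w : V} (hu : u ≠ h) (hv : v ≠ h) (hw : w ≠ h)
    (huv : G.Adj u v) (hvw : G.Adj v w) (huw : u ≠ w) :
    Relation.ReflTransGen (ModelStep G ⊤) (pairLabel a b c u v) (pairLabel a b c v w) := by
  have h1 : IsSplit G h {u} {v, w} :=
    ⟨by simpa using hu.symm, by simp [hv.symm, hw.symm], by simp [huv.ne, huw],
      connected_induce_singleton u, induce_pair_connected_of_adj hvw, u, rfl, v, by simp, huv⟩
  have h2 : IsSplit G h {u, v} {w} :=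
    ⟨by simp [hu.symm, hv.symm], by simpa using hw.symm, by simp [hvw.ne.symm, huw.symm],
      induce_pair_connected_of_adj huv, connected_induce_singleton w, v, by simp, w, rfl, hvw⟩
  refine (reflTransGen_modelStep_symm (h1.reflTransGen_singleton_right hh hab hac hbc rfl
    (by simp) huv)).trans (.trans ?_
    (h2.reflTransGen_singleton_left hh hab hac hbc (by simp) rfl hvw))
  refine reflTransGen_modelStep_of_eqOn_compl (h1.isModel hh hab hac hbc)
    (h2.isModel hh hab hac hbc) v fun z hz => ?_
  exact splitLabel_apply_congr (by simp [hz]) (by simp [hz])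

lemma reflTransGen_pairLabel_rotate [Finite V] {h : V} (hh : ∀ x, x ≠ h → G.Adj h x)
    {a b c : Fin 3} (hab : a ≠ b) (hac : a ≠ c) (hbc : b ≠ c)
    {u v w : V} (hu : u ≠ h) (hv : v ≠ h) (hw : w ≠ h)
    (huv : G.Adj u v) (hwu : G.Adj w u) (hvw : v ≠ w)
    (hconn : (G.induce {x | x ≠ h ∧ x ≠ u ∧ x ≠ w}).Connected) :
    Relation.ReflTransGen (ModelStep G ⊤) (pairLabel a b c u v) (pairLabel c a b w u) := by
  have hS : IsSplit G h {u} {x | x ≠ h ∧ x ≠ u ∧ x ≠ w} :=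
    ⟨by simpa using hu.symm, by simp, by simp, connected_induce_singleton u, hconn,
      u, rfl, v, ⟨hv, huv.ne.symm, hvw⟩, huv⟩
  refine (reflTransGen_modelStep_symm (hS.reflTransGen_singleton_right hh hab hac hbc rfl
    ⟨hv, huv.ne.symm, hvw⟩ huv)).trans ?_
  refine reflTransGen_modelStep_of_eqOn_compl (hS.isModel hh hab hac hbc)
    ((isSplit_singletons hw hu hwu).isModel hh hac.symm hbc.symm hab) h fun z hz => ?_
  have := hwu.ne
  by_cases h1 : z = u <;> by_cases h2 : z = w <;> simp_all [splitLabel]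

end Cone

section Wheel

lemma wheelGraph_adj_none {n : ℕ} {x : Option (Fin n)} (hx : x ≠ none) :
    (wheelGraph n).Adj none x := by
  obtain ⟨i, rfl⟩ := Option.ne_none_iff_exists'.1 hx
  simp [wheelGraph]

/-- The rim vertices of the wheel, indexed periodically by the natural numbers. -/
def rimVertex (n : ℕ) [NeZero n] (k : ℕ) : Option (Fin n) :=
  some ⟨k % n, Nat.mod_lt _ (NeZero.pos n)⟩

variable {n : ℕ} [NeZero n]

lemma rimVertex_ne_none (k : ℕ) : rimVertex n k ≠ none := by simp [rimVertex]

lemma rimVertex_eq_iff {k l : ℕ} : rimVertex n k = rimVertex n l ↔ k ≡ l [MOD n] := by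
  simp [rimVertex, Nat.ModEq]

lemma rimVertex_add_inj {m j l : ℕ} (hj : j < n) (hl : l < n) :
    rimVertex n (m + j) = rimVertex n (m + l) ↔ j = l := by
  rw [rimVertex_eq_iff]
  refine ⟨fun h => (Nat.ModEq.add_left_cancel' m h).eq_of_lt_of_lt hj hl, fun h => h ▸ rfl⟩

lemma exists_rimVertex_add_eq (m : ℕ) {x : Option (Fin n)} (hx : x ≠ none) :
    ∃ j < n, x = rimVertex n (m + j) := by
  obtain ⟨i, rfl⟩ := Option.ne_none_iff_exists'.1 hx
  have hm := Nat.mod_lt m (NeZero.pos n)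
  refine ⟨(i + (n - m % n)) % n, Nat.mod_lt _ (NeZero.pos n), ?_⟩
  simp only [rimVertex, Option.some.injEq, Fin.ext_iff]
  rw [Nat.add_mod_mod, Nat.add_mod, ← Nat.mod_add_mod, Nat.mod_mod, ← Nat.add_mod,
    ← Nat.mod_add_mod, show m % n + (i + (n - m % n)) = i + n by omega, Nat.add_mod_right,
    Nat.mod_eq_of_lt i.2]

lemma wheelGraph_adj_rimVertex (hn : 2 ≤ n) (k : ℕ) :
    (wheelGraph n).Adj (rimVertex n k) (rimVertex n (k + 1)) := by
  have hne : rimVertex n k ≠ rimVertex n (k + 1) := fun h =>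
    absurd ((rimVertex_add_inj (n := n) (m := k) (j := 0) (l := 1) (by omega) (by omega)).1 h)
      (by omega)
  rw [wheelGraph, fromRel_adj]
  exact ⟨hne, .inl (by simp [rimVertex])⟩

lemma exists_rimVertex_of_wheelGraph_adj {u v : Option (Fin n)} (hu : u ≠ none) (hv : v ≠ none)
    (huv : (wheelGraph n).Adj u v) : ∃ k, u = rimVertex n k ∧ v = rimVertex n (k + 1) ∨
      v = rimVertex n k ∧ u = rimVertex n (k + 1) := by
  obtain ⟨i, rfl⟩ := Option.ne_none_iff_exists'.1 hu
  obtain ⟨j, rfl⟩ := Option.ne_none_iff_exists'.1 hv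
  rw [wheelGraph, fromRel_adj] at huv
  rcases huv.2 with h | h
  · refine ⟨i, .inl ⟨?_, ?_⟩⟩ <;> simp [rimVertex, Fin.ext_iff, Nat.mod_eq_of_lt, h]
  · refine ⟨j, .inr ⟨?_, ?_⟩⟩ <;> simp [rimVertex, Fin.ext_iff, Nat.mod_eq_of_lt, h]

lemma connected_induce_arc (hn : 2 ≤ n) (m k : ℕ) :
    ((wheelGraph n).induce {x | ∃ j ≤ k, x = rimVertex n (m + j)}).Connected := by
  induction k with
  | zero =>
    have : {x | ∃ j ≤ 0, x = rimVertex n (m + j)} = {rimVertex n m} := by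
      ext x
      simp
    rw [this]
    exact connected_induce_singleton _
  | succ k ih =>
    have : {x | ∃ j ≤ k + 1, x = rimVertex n (m + j)} =
        insert (rimVertex n (m + k + 1)) {x | ∃ j ≤ k, x = rimVertex n (m + j)} := by
      ext x
      simp only [Set.mem_ofPred_eq, Set.mem_insert_iff]
      constructor
      · rintro ⟨j, hj, rfl⟩
        rcases hj.eq_or_lt with rfl | hj
        · exact .inl rfl
        · exact .inr ⟨j, by omega, rfl⟩
      · rintro (rfl | ⟨j, hj, rfl⟩)
        · exact ⟨k + 1, le_rfl, rfl⟩
        · exact ⟨j, by omega, rfl⟩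
    rw [this]
    exact connected_induce_insert ih ⟨k, le_rfl, rfl⟩ (wheelGraph_adj_rimVertex hn _)

lemma connected_induce_rim_sdiff_singleton (hn : 2 ≤ n) (m : ℕ) :
    ((wheelGraph n).induce {x | x ≠ none ∧ x ≠ rimVertex n m}).Connected := by
  suffices {x | x ≠ none ∧ x ≠ rimVertex n m} =
      {x | ∃ j ≤ n - 2, x = rimVertex n (m + 1 + j)} from
    this ▸ connected_induce_arc hn (m + 1) (n - 2)
  ext x
  constructor
  · rintro ⟨h0, h1⟩
    obtain ⟨j, hj, rfl⟩ := exists_rimVertex_add_eq m h0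
    have : j ≠ 0 := by rintro rfl; exact h1 rfl
    exact ⟨j - 1, by omega, congrArg _ (by omega)⟩
  · rintro ⟨j, hj, rfl⟩
    refine ⟨rimVertex_ne_none _, fun h => ?_⟩
    rw [add_assoc] at h
    have := (rimVertex_add_inj (l := 0) (by omega) (by omega)).1 h
    omega

lemma connected_induce_rim_sdiff_pair (hn : 3 ≤ n) (m : ℕ) :
    ((wheelGraph n).induce
      {x | x ≠ none ∧ x ≠ rimVertex n (m + 1) ∧ x ≠ rimVertex n m}).Connected := by
  suffices {x | x ≠ none ∧ x ≠ rimVertex n (m + 1) ∧ x ≠ rimVertex n m} =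
      {x | ∃ j ≤ n - 3, x = rimVertex n (m + 2 + j)} from
    this ▸ connected_induce_arc (by omega) (m + 2) (n - 3)
  ext x
  constructor
  · rintro ⟨h0, h1, h2⟩
    obtain ⟨j, hj, rfl⟩ := exists_rimVertex_add_eq m h0
    have : j ≠ 0 := by rintro rfl; exact h2 rfl
    have : j ≠ 1 := by rintro rfl; exact h1 rfl
    exact ⟨j - 2, by omega, congrArg _ (by omega)⟩
  · rintro ⟨j, hj, rfl⟩
    refine ⟨rimVertex_ne_none _, fun h => ?_, fun h => ?_⟩
    · rw [add_assoc] at h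
      have := (rimVertex_add_inj (by omega) (by omega)).1 h
      omega
    · rw [add_assoc] at h
      have := (rimVertex_add_inj (l := 0) (by omega) (by omega)).1 h
      omega

lemma rimVertex_ne_add_two (hn : 3 ≤ n) (k : ℕ) : rimVertex n k ≠ rimVertex n (k + 2) := fun h =>
  absurd ((rimVertex_add_inj (n := n) (m := k) (j := 0) (by omega) (by omega)).1 h) (by omega)

lemma reflTransGen_rimVertex_zero (hn : 3 ≤ n) {a b c : Fin 3} (hab : a ≠ b) (hac : a ≠ c)
    (hbc : b ≠ c) (k : ℕ) :
    Relation.ReflTransGen (ModelStep (wheelGraph n) ⊤)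
      (pairLabel a b c (rimVertex n k) (rimVertex n (k + 1)))
      (pairLabel a b c (rimVertex n 0) (rimVertex n 1)) := by
  induction k with
  | zero => exact .refl
  | succ k ih =>
    exact (reflTransGen_modelStep_symm (reflTransGen_pairLabel_slide
      (fun _ => wheelGraph_adj_none) hab hac hbc (rimVertex_ne_none _) (rimVertex_ne_none _)
      (rimVertex_ne_none _) (wheelGraph_adj_rimVertex (by omega) _)
      (wheelGraph_adj_rimVertex (by omega) _) (rimVertex_ne_add_two hn k))).trans ih

lemma reflTransGen_rimVertex_swap (hn : 3 ≤ n) {a b c : Fin 3} (hab : a ≠ b) (hac : a ≠ c)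
    (hbc : b ≠ c) (k : ℕ) :
    Relation.ReflTransGen (ModelStep (wheelGraph n) ⊤)
      (pairLabel a b c (rimVertex n (k + 1)) (rimVertex n k))
      (pairLabel a b c (rimVertex n 0) (rimVertex n 1)) :=
  (reflTransGen_pairLabel_flip (fun _ => wheelGraph_adj_none) hab hac hbc (rimVertex_ne_none _)
    (rimVertex_ne_none _) (rimVertex_ne_none _) (wheelGraph_adj_rimVertex (by omega) _).symm
    (wheelGraph_adj_rimVertex (by omega) _)
    (connected_induce_rim_sdiff_singleton (by omega) _)).trans
    (reflTransGen_rimVertex_zero hn hab hac hbc (k + 1))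

lemma reflTransGen_label_swap (hn : 3 ≤ n) {a b c : Fin 3} (hab : a ≠ b) (hac : a ≠ c)
    (hbc : b ≠ c) :
    Relation.ReflTransGen (ModelStep (wheelGraph n) ⊤)
      (pairLabel a b c (rimVertex n 0) (rimVertex n 1))
      (pairLabel a c b (rimVertex n 0) (rimVertex n 1)) := by
  rw [pairLabel_swap (wheelGraph_adj_rimVertex (by omega) 0).ne]
  exact reflTransGen_rimVertex_swap hn hac hab hbc.symm 0

lemma reflTransGen_label_rotate (hn : 3 ≤ n) {a b c : Fin 3} (hab : a ≠ b) (hac : a ≠ c)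
    (hbc : b ≠ c) :
    Relation.ReflTransGen (ModelStep (wheelGraph n) ⊤)
      (pairLabel a b c (rimVertex n 0) (rimVertex n 1))
      (pairLabel c a b (rimVertex n 0) (rimVertex n 1)) :=
  (reflTransGen_modelStep_symm (reflTransGen_rimVertex_zero hn hab hac hbc 1)).trans
    (reflTransGen_pairLabel_rotate (fun _ => wheelGraph_adj_none) hab hac hbc
      (rimVertex_ne_none _) (rimVertex_ne_none _) (rimVertex_ne_none _)
      (wheelGraph_adj_rimVertex (by omega) _) (wheelGraph_adj_rimVertex (by omega) _)
      (rimVertex_ne_add_two hn 0).symm (connected_induce_rim_sdiff_pair hn 0))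

lemma reflTransGen_label_standard (hn : 3 ≤ n) {a b c : Fin 3} (hab : a ≠ b) (hac : a ≠ c)
    (hbc : b ≠ c) :
    Relation.ReflTransGen (ModelStep (wheelGraph n) ⊤)
      (pairLabel a b c (rimVertex n 0) (rimVertex n 1))
      (pairLabel 0 1 2 (rimVertex n 0) (rimVertex n 1)) := by
  have perms : (a = 0 ∧ b = 1 ∧ c = 2) ∨ (a = 1 ∧ b = 2 ∧ c = 0) ∨ (a = 2 ∧ b = 0 ∧ c = 1) ∨
      (a = 0 ∧ b = 2 ∧ c = 1) ∨ (a = 2 ∧ b = 1 ∧ c = 0) ∨ (a = 1 ∧ b = 0 ∧ c = 2) := by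
    omega
  have h120 := reflTransGen_label_rotate hn (a := 1) (b := 2) (c := 0) (by decide) (by decide)
    (by decide)
  have h201 := reflTransGen_label_rotate hn (a := 2) (b := 0) (c := 1) (by decide) (by decide)
    (by decide)
  have hs := reflTransGen_label_swap hn hab hac hbc
  rcases perms with ⟨rfl, rfl, rfl⟩ | ⟨rfl, rfl, rfl⟩ | ⟨rfl, rfl, rfl⟩ | ⟨rfl, rfl, rfl⟩ |
    ⟨rfl, rfl, rfl⟩ | ⟨rfl, rfl, rfl⟩
  · exact .refl
  · exact h120
  · exact h201.trans h120
  · exact hs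
  · exact hs.trans (h201.trans h120)
  · exact hs.trans h120

lemma reflTransGen_standard (hn : 3 ≤ n) {f : Option (Fin n) → Fin 3}
    (hf : IsModel (wheelGraph n) ⊤ f) :
    Relation.ReflTransGen (ModelStep (wheelGraph n) ⊤) f
      (pairLabel 0 1 2 (rimVertex n 0) (rimVertex n 1)) := by
  obtain ⟨a, b, c, u, v, hab, hac, hbc, hu, hv, huv, h⟩ :=
    exists_reflTransGen_pairLabel (fun _ => wheelGraph_adj_none) hf
  refine h.trans (.trans ?_ (reflTransGen_label_standard hn hab hac hbc))
  obtain ⟨k, ⟨rfl, rfl⟩ | ⟨rfl, rfl⟩⟩ := exists_rimVertex_of_wheelGraph_adj hu hv huv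
  · exact reflTransGen_rimVertex_zero hn hab hac hbc k
  · exact reflTransGen_rimVertex_swap hn hab hac hbc k

end Wheel

/-- For every `n ≥ 3`, the wheel `W_n` is in `host(K₃)`. -/
theorem stmt4 (n : ℕ) (hn : 3 ≤ n) :
    InHost (wheelGraph n) (⊤ : SimpleGraph (Fin 3)) := by
  have : NeZero n := ⟨by omega⟩
  refine ⟨⟨_, (isSplit_singletons (rimVertex_ne_none 0) (rimVertex_ne_none 1)
    (wheelGraph_adj_rimVertex (by omega) 0)).isModel (fun _ => wheelGraph_adj_none)
    (a := 0) (b := 1) (c := 2) (by decide) (by decide) (by decide)⟩, fun f g hf hg => ?_⟩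
  exact (reflTransGen_standard hn hf).trans
    (reflTransGen_modelStep_symm (reflTransGen_standard hn hg))
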